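/- arXiv:1711.06712 — 2 statements merged into one kernel-verified Lean document; each statement's English description precedes it below -/
import Mathlib

section
/- Let Σ and Σ̃ be symmetric positive definite matrices in ℝ^{K×K}. Let w be a minimizer of vᵀΣv over the unit simplex Ω and let w̃ be a minimizer of vᵀΣ̃v over Ω. Define Δ = ‖Σ̃Σ⁻¹ − Σ̃⁻¹Σ‖₂, the ℓ²-operator norm of the matrix Σ̃Σ⁻¹ − Σ̃⁻¹Σ. Then (w̃ − w)ᵀΣ(w̃ − w) ≤ (wᵀΣw)·(2Δ + Δ²). -/
open Matrix Finset

/-- The unit simplex in ℝ^K. -/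
def unitSimplex (K : ℕ) : Set (Fin K → ℝ) :=
  {w | (∑ k, w k) = 1 ∧ ∀ k, 0 ≤ w k}

/-- The ℓ²-operator norm of a real `K×K` matrix, i.e. the norm of the induced continuous
linear map on Euclidean space. -/
noncomputable def l2OpNorm {K : ℕ} (A : Matrix (Fin K) (Fin K) ℝ) : ℝ :=
  ‖Matrix.toEuclideanCLM (𝕜 := ℝ) A‖

/-- The largest generalized eigenvalue of `B` relative to a positive definite `A` is attained and
bounds the quadratic form of `B` by that of `A`. -/
theorem exists_generalized_eigenvector_bound {n : Type*} [Fintype n] [Nonempty n]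
    {A B : Matrix n n ℝ} (hA : A.PosDef) (hB : B.IsHermitian) :
    ∃ (l : ℝ) (x : n → ℝ), x ≠ 0 ∧ B *ᵥ x = l • A *ᵥ x ∧
      ∀ v, v ⬝ᵥ B *ᵥ v ≤ l * (v ⬝ᵥ A *ᵥ v) := by
  have hpos : ∀ v : n → ℝ, v ≠ 0 → 0 < v ⬝ᵥ A *ᵥ v := fun v hv => by
    simpa using hA.dotProduct_mulVec_pos hv
  have hne : ∀ v ∈ Metric.sphere (0 : n → ℝ) 1, v ≠ 0 := fun v hv =>
    ne_zero_of_mem_unit_sphere ⟨v, hv⟩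
  obtain ⟨x, hx, hmax⟩ := (isCompact_sphere (0 : n → ℝ) 1).exists_isMaxOn
    (NormedSpace.sphere_nonempty.2 zero_le_one)
    (f := fun v => (v ⬝ᵥ B *ᵥ v) / (v ⬝ᵥ A *ᵥ v))
    (ContinuousOn.div (by fun_prop) (by fun_prop) fun v hv => (hpos v (hne v hv)).ne')
  set l := (x ⬝ᵥ B *ᵥ x) / (x ⬝ᵥ A *ᵥ x) with hl
  have hx0 := hne x hx
  have hbound : ∀ v, v ⬝ᵥ B *ᵥ v ≤ l * (v ⬝ᵥ A *ᵥ v) := by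
    intro v
    rcases eq_or_ne v 0 with rfl | hv
    · simp
    have hv' : 0 < ‖v‖ := norm_pos_iff.2 hv
    have hu : ‖v‖⁻¹ • v ∈ Metric.sphere (0 : n → ℝ) 1 := by
      simp [norm_smul, hv'.ne']
    have h := (div_le_iff₀ (hpos _ (hne _ hu))).1 (hmax hu)
    simp only [mulVec_smul, smul_dotProduct, dotProduct_smul, smul_eq_mul] at h
    have hi : 0 < ‖v‖⁻¹ * ‖v‖⁻¹ := by positivity
    refine le_of_mul_le_mul_left ?_ hi
    linarith
  refine ⟨l, x, hx0, ?_, hbound⟩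
  have hpsd : (l • A - B).PosSemidef := by
    refine .of_dotProduct_mulVec_nonneg ?_ fun v => ?_
    · exact (hA.isHermitian.smul (IsSelfAdjoint.all l)).sub hB
    · have := hbound v
      simpa [sub_mulVec, smul_mulVec, dotProduct_sub] using this
  have hzero : (l • A - B) *ᵥ x = 0 := by
    rw [← hpsd.dotProduct_mulVec_zero_iff]
    simp [sub_mulVec, smul_mulVec, dotProduct_sub, hl, (hpos x hx0).ne']
  rw [sub_mulVec, smul_mulVec, sub_eq_zero] at hzero
  exact hzero.symm

theorem abs_dotProduct_mulVec_le_l2OpNorm {K : ℕ} (A : Matrix (Fin K) (Fin K) ℝ)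
    (y : Fin K → ℝ) : |y ⬝ᵥ A *ᵥ y| ≤ l2OpNorm A * (y ⬝ᵥ y) := by
  set z : EuclideanSpace ℝ (Fin K) := WithLp.toLp 2 y
  have hinner : inner ℝ z (toEuclideanCLM (𝕜 := ℝ) A z) = y ⬝ᵥ A *ᵥ y := by
    simp [z, EuclideanSpace.inner_eq_star_dotProduct, dotProduct_comm]
  have hnorm : ‖z‖ * ‖z‖ = y ⬝ᵥ y := by
    rw [← real_inner_self_eq_norm_mul_norm, EuclideanSpace.inner_eq_star_dotProduct, star_trivial]
  rw [← hinner, ← hnorm, l2OpNorm]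
  calc _ ≤ ‖z‖ * ‖toEuclideanCLM (𝕜 := ℝ) A z‖ := abs_real_inner_le_norm _ _
    _ ≤ ‖z‖ * (‖toEuclideanCLM (𝕜 := ℝ) A‖ * ‖z‖) := by
      gcongr
      exact ContinuousLinearMap.le_opNorm _ _
    _ = _ := by ring

/-- A generalized eigenvalue `l` of `T` relative to `S` satisfies `|l - l⁻¹| ≤ Δ`. -/
theorem abs_sub_inv_le_l2OpNorm {K : ℕ} {S T : Matrix (Fin K) (Fin K) ℝ} (hS : S.PosDef)
    (hT : T.PosDef) {l : ℝ} (hl : l ≠ 0) {x : Fin K → ℝ} (hx : x ≠ 0)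
    (h : T *ᵥ x = l • S *ᵥ x) : |l - l⁻¹| ≤ l2OpNorm (T * S⁻¹ - T⁻¹ * S) := by
  have hSu := (isUnit_iff_isUnit_det S).1 hS.isUnit
  have hTu := (isUnit_iff_isUnit_det T).1 hT.isUnit
  set y := S *ᵥ x with hy
  have hSy : S⁻¹ *ᵥ y = x := by
    rw [hy, mulVec_mulVec, nonsing_inv_mul _ hSu, one_mulVec]
  have hTx : T⁻¹ *ᵥ y = l⁻¹ • x := by
    have : y = l⁻¹ • T *ᵥ x := by rw [h, smul_smul, inv_mul_cancel₀ hl, one_smul]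
    rw [this, mulVec_smul, mulVec_mulVec, nonsing_inv_mul _ hTu, one_mulVec]
  have hy0 : y ≠ 0 := fun h0 => hx (by rw [← hSy, h0, mulVec_zero])
  have hyy : 0 < y ⬝ᵥ y := by simpa using dotProduct_star_self_pos_iff.2 hy0
  have hTt : (T⁻¹)ᵀ = T⁻¹ := by
    simpa [IsHermitian, conjTranspose_eq_transpose_of_trivial] using hT.isHermitian.inv
  have hSt : Sᵀ = S := by
    simpa [IsHermitian, conjTranspose_eq_transpose_of_trivial] using hS.isHermitian
  have hquad : y ⬝ᵥ (T * S⁻¹ - T⁻¹ * S) *ᵥ y = (l - l⁻¹) * (y ⬝ᵥ y) := by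
    have h2 : y ⬝ᵥ T⁻¹ *ᵥ (S *ᵥ y) = l⁻¹ * (y ⬝ᵥ y) := by
      rw [dotProduct_mulVec, ← mulVec_transpose, hTt, hTx, smul_dotProduct, dotProduct_mulVec,
        ← mulVec_transpose, hSt, ← hy, smul_eq_mul]
    rw [sub_mulVec, dotProduct_sub, ← mulVec_mulVec, ← mulVec_mulVec, hSy, h, h2, dotProduct_smul,
      smul_eq_mul]
    ring
  have hmain := abs_dotProduct_mulVec_le_l2OpNorm (T * S⁻¹ - T⁻¹ * S) y
  rw [hquad, abs_mul, abs_of_pos hyy] at hmain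
  exact le_of_mul_le_mul_right hmain hyy

theorem le_one_add_of_sub_inv_le {l d : ℝ} (hd : 0 ≤ d) (h : l - l⁻¹ ≤ d) : l ≤ 1 + d := by
  by_contra! hl
  have : l⁻¹ ≤ 1 := inv_le_one_of_one_le₀ (by linarith)
  linarith

theorem dotProduct_mulVec_le_one_add_l2OpNorm {K : ℕ} [NeZero K]
    {S T : Matrix (Fin K) (Fin K) ℝ} (hS : S.PosDef) (hT : T.PosDef) (v : Fin K → ℝ) :
    v ⬝ᵥ T *ᵥ v ≤ (1 + l2OpNorm (T * S⁻¹ - T⁻¹ * S)) * (v ⬝ᵥ S *ᵥ v) ∧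
      v ⬝ᵥ S *ᵥ v ≤ (1 + l2OpNorm (T * S⁻¹ - T⁻¹ * S)) * (v ⬝ᵥ T *ᵥ v) := by
  have hd : 0 ≤ l2OpNorm (T * S⁻¹ - T⁻¹ * S) := norm_nonneg _
  have hSv : 0 ≤ v ⬝ᵥ S *ᵥ v := by simpa using hS.posSemidef.dotProduct_mulVec_nonneg v
  have hTv : 0 ≤ v ⬝ᵥ T *ᵥ v := by simpa using hT.posSemidef.dotProduct_mulVec_nonneg v
  have hne : ∀ {A B : Matrix (Fin K) (Fin K) ℝ} {l : ℝ} {x : Fin K → ℝ}, B.PosDef → x ≠ 0 →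
      B *ᵥ x = l • A *ᵥ x → l ≠ 0 := by
    rintro A B l x hB hx h rfl
    have := hB.dotProduct_mulVec_pos hx
    simp [h] at this
  constructor
  · obtain ⟨l, x, hx, h, hb⟩ := exists_generalized_eigenvector_bound hS hT.isHermitian
    have hl := abs_sub_inv_le_l2OpNorm hS hT (hne hT hx h) hx h
    exact (hb v).trans (mul_le_mul_of_nonneg_right
      (le_one_add_of_sub_inv_le hd ((le_abs_self _).trans hl)) hSv)
  · obtain ⟨l, x, hx, h, hb⟩ := exists_generalized_eigenvector_bound hT hS.isHermitian
    have hl0 := hne hS hx h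
    have h' : T *ᵥ x = l⁻¹ • S *ᵥ x := by rw [h, smul_smul, inv_mul_cancel₀ hl0, one_smul]
    have hl := abs_sub_inv_le_l2OpNorm hS hT (inv_ne_zero hl0) hx h'
    rw [inv_inv, abs_sub_comm] at hl
    exact (hb v).trans (mul_le_mul_of_nonneg_right
      (le_one_add_of_sub_inv_le hd ((le_abs_self _).trans hl)) hTv)

/-- Quadratic growth of a quadratic form away from a minimizer over a convex set. -/
theorem dotProduct_mulVec_sub_le_of_isMinOn {n : Type*} [Fintype n] {S : Matrix n n ℝ}
    (hS : S.IsHermitian) {C : Set (n → ℝ)} (hC : Convex ℝ C) {w v : n → ℝ} (hw : w ∈ C)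
    (hmin : ∀ u ∈ C, w ⬝ᵥ S *ᵥ w ≤ u ⬝ᵥ S *ᵥ u) (hv : v ∈ C) :
    (v - w) ⬝ᵥ S *ᵥ (v - w) ≤ v ⬝ᵥ S *ᵥ v - w ⬝ᵥ S *ᵥ w := by
  have hsymm : ∀ a b : n → ℝ, a ⬝ᵥ S *ᵥ b = b ⬝ᵥ S *ᵥ a := fun a b => by
    rw [dotProduct_mulVec, ← mulVec_transpose, ← conjTranspose_eq_transpose_of_trivial, hS,
      dotProduct_comm]
  set d := v - w with hd
  have hexp : ∀ t : ℝ, (w + t • d) ⬝ᵥ S *ᵥ (w + t • d) =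
      w ⬝ᵥ S *ᵥ w + 2 * t * (w ⬝ᵥ S *ᵥ d) + t ^ 2 * (d ⬝ᵥ S *ᵥ d) := fun t => by
    simp only [mulVec_add, mulVec_smul, add_dotProduct, dotProduct_add, smul_dotProduct,
      dotProduct_smul, smul_eq_mul, hsymm d w]
    ring
  have hv1 : v ⬝ᵥ S *ᵥ v = w ⬝ᵥ S *ᵥ w + 2 * (w ⬝ᵥ S *ᵥ d) + d ⬝ᵥ S *ᵥ d := by
    have h := hexp 1
    rw [one_smul, hd, add_sub_cancel] at h
    linarith
  have hfirst : 0 ≤ w ⬝ᵥ S *ᵥ d := by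
    have hstep : ∀ t ∈ Set.Ioc (0 : ℝ) 1, 0 ≤ 2 * (w ⬝ᵥ S *ᵥ d) + t * (d ⬝ᵥ S *ᵥ d) := by
      intro t ht
      have h := hmin _ (hC.add_smul_sub_mem hw hv ⟨ht.1.le, ht.2⟩)
      rw [← hd, hexp] at h
      refine le_of_mul_le_mul_left ?_ ht.1
      linarith
    by_contra! hneg
    have hdd : 0 < d ⬝ᵥ S *ᵥ d := by linarith [hstep 1 ⟨one_pos, le_rfl⟩]
    have ht : 0 < -(w ⬝ᵥ S *ᵥ d) / (d ⬝ᵥ S *ᵥ d) := div_pos (neg_pos.2 hneg) hdd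
    have h := hstep (-(w ⬝ᵥ S *ᵥ d) / (d ⬝ᵥ S *ᵥ d)) ⟨ht, by
      rw [div_le_one hdd]
      linarith [hstep 1 ⟨one_pos, le_rfl⟩]⟩
    rw [div_mul_cancel₀ _ hdd.ne'] at h
    linarith
  linarith

theorem convex_unitSimplex (K : ℕ) : Convex ℝ (unitSimplex K) := by
  have h : unitSimplex K = stdSimplex ℝ (Fin K) := by
    ext w
    exact and_comm
  exact h ▸ convex_stdSimplex ℝ (Fin K)

/-- **Proposition 5, perturbation bound.** Let `Σ` and `Σ̃` be symmetric
positive definite, let `w` minimize `vᵀΣv` over the unit simplex and `w̃` minimize `vᵀΣ̃v`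
over the unit simplex, and set `Δ = ‖Σ̃Σ⁻¹ − Σ̃⁻¹Σ‖₂`.  Then
`(w̃ − w)ᵀΣ(w̃ − w) ≤ (wᵀΣw)(2Δ + Δ²)`. -/
theorem perturbation_bound {K : ℕ}
    (S St : Matrix (Fin K) (Fin K) ℝ) (hS : S.PosDef) (hSt : St.PosDef)
    (w wt : Fin K → ℝ)
    (hw : w ∈ unitSimplex K ∧ ∀ v ∈ unitSimplex K, w ⬝ᵥ S.mulVec w ≤ v ⬝ᵥ S.mulVec v)
    (hwt : wt ∈ unitSimplex K ∧ ∀ v ∈ unitSimplex K, wt ⬝ᵥ St.mulVec wt ≤ v ⬝ᵥ St.mulVec v)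
    (Δ : ℝ) (hΔ : Δ = l2OpNorm (St * S⁻¹ - St⁻¹ * S)) :
    (wt - w) ⬝ᵥ S.mulVec (wt - w) ≤ (w ⬝ᵥ S.mulVec w) * (2 * Δ + Δ ^ 2) := by
  subst hΔ
  set Δ := l2OpNorm (St * S⁻¹ - St⁻¹ * S)
  have hΔ0 : 0 ≤ Δ := norm_nonneg _
  have : NeZero K := ⟨by
    rintro rfl
    simpa using hw.1.1⟩
  have hgrowth := dotProduct_mulVec_sub_le_of_isMinOn hS.isHermitian
    (convex_unitSimplex K) hw.1 hw.2 hwt.1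
  have hlower := (dotProduct_mulVec_le_one_add_l2OpNorm hS hSt wt).2
  have hupper := (dotProduct_mulVec_le_one_add_l2OpNorm hS hSt w).1
  have hchain : wt ⬝ᵥ S *ᵥ wt ≤ (1 + Δ) * ((1 + Δ) * (w ⬝ᵥ S *ᵥ w)) :=
    hlower.trans (mul_le_mul_of_nonneg_left ((hwt.2 w hw.1).trans hupper) (by positivity))
  linarith
end

section
/- Let M ∈ ℝ^{N×N} be symmetric with spectral decomposition M = ∑_{i=1}^N λ_i u_i u_iᵀ, where {u_i} is an orthonormal basis of eigenvectors with eigenvalues λ_i. Define M₊ = ∑_{i=1}^N max(λ_i, 0) u_i u_iᵀ. Then M₊ is symmetric positive semidefinite, and for every symmetric positive semidefinite matrix S ∈ ℝ^{N×N}, ‖S − M‖_F ≥ ‖M₊ − M‖_F; i.e., M₊ minimizes the Frobenius distance to M over all positive semidefinite matrices. -/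
open Matrix Finset

/-- The Frobenius norm of a real matrix, `‖A‖_F = (∑_{i,j} A_{ij}²)^{1/2}`. -/
noncomputable def frobNorm {N : ℕ} (A : Matrix (Fin N) (Fin N) ℝ) : ℝ :=
  Real.sqrt (∑ i, ∑ j, (A i j) ^ 2)

/-- The Frobenius inner product of `A` with `∑ c_k u_k u_kᵀ` is `∑ c_k u_kᵀ A u_k`. -/
lemma sum_mul_sum_smul_vecMulVec_self {n ι : Type*} [Fintype n] [Fintype ι]
    (A : Matrix n n ℝ) (c : ι → ℝ) (u : ι → n → ℝ) :
    ∑ i, ∑ j, A i j * (∑ k, c k • vecMulVec (u k) (u k)) i j =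
      ∑ k, c k * (u k ⬝ᵥ A *ᵥ u k) := by
  have h (i j : n) : A i j * (∑ k, c k • vecMulVec (u k) (u k)) i j =
      ∑ k, c k * (u k i * (A i j * u k j)) := by
    rw [Matrix.sum_apply, Finset.mul_sum]
    refine Finset.sum_congr rfl fun k _ => ?_
    simp only [Matrix.smul_apply, vecMulVec_apply, smul_eq_mul]
    ring
  simp only [h, dotProduct, mulVec, Finset.mul_sum]
  rw [Finset.sum_comm_cycle]

/-- For orthonormal `u`, the quadratic form of `∑ c_k u_k u_kᵀ` at `u_l` is `c_l`. -/
lemma dotProduct_sum_smul_vecMulVec_mulVec {n ι : Type*} [Fintype n] [Fintype ι] [DecidableEq ι]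
    (c : ι → ℝ) (u : ι → n → ℝ)
    (horth : ∀ i j, u i ⬝ᵥ u j = if i = j then (1 : ℝ) else 0) (l : ι) :
    u l ⬝ᵥ (∑ k, c k • vecMulVec (u k) (u k)) *ᵥ u l = c l := by
  simp [Matrix.sum_mulVec, Matrix.smul_mulVec, vecMulVec_mulVec, horth]

/-- If the Frobenius inner product of `B - A` with `A` is nonnegative, then `‖A‖_F ≤ ‖B‖_F`. -/
lemma frobNorm_le_of_inner_sub_nonneg {N : ℕ} (A B : Matrix (Fin N) (Fin N) ℝ)
    (h : 0 ≤ ∑ i, ∑ j, (B - A) i j * A i j) : frobNorm A ≤ frobNorm B := by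
  refine Real.sqrt_le_sqrt ?_
  have key : ∑ i, ∑ j, (B i j) ^ 2 = ∑ i, ∑ j, ((B - A) i j) ^ 2 +
      2 * ∑ i, ∑ j, (B - A) i j * A i j + ∑ i, ∑ j, (A i j) ^ 2 := by
    simp only [Finset.mul_sum, ← Finset.sum_add_distrib]
    refine Finset.sum_congr rfl fun i _ => Finset.sum_congr rfl fun j _ => ?_
    rw [Matrix.sub_apply]
    ring
  have hsq : 0 ≤ ∑ i, ∑ j, ((B - A) i j) ^ 2 := by positivity
  linarith

/-- Let `M` be symmetric with spectral decomposition
`M = ∑ λ_i u_i u_iᵀ` for an orthonormal basis of eigenvectors `{u_i}`.  Then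
`M₊ = ∑ max(λ_i,0) u_i u_iᵀ` is symmetric positive semidefinite, and for every symmetric
positive semidefinite `S`, `‖S − M‖_F ≥ ‖M₊ − M‖_F`: `M₊` is the closest positive
semidefinite matrix to `M` in Frobenius distance. -/
theorem psd_projection_truncates_negative_eigenvalues {N : ℕ}
    (M : Matrix (Fin N) (Fin N) ℝ)
    (u : Fin N → (Fin N → ℝ)) (lam : Fin N → ℝ)
    (horth : ∀ i j, u i ⬝ᵥ u j = if i = j then (1 : ℝ) else 0)
    (hM : M = ∑ i, lam i • vecMulVec (u i) (u i))
    (Mplus : Matrix (Fin N) (Fin N) ℝ)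
    (hMplus : Mplus = ∑ i, max (lam i) 0 • vecMulVec (u i) (u i)) :
    Mplus.PosSemidef ∧
    ∀ S : Matrix (Fin N) (Fin N) ℝ, S.PosSemidef →
      frobNorm (Mplus - M) ≤ frobNorm (S - M) := by
  refine ⟨?_, fun S hS => frobNorm_le_of_inner_sub_nonneg _ _ ?_⟩
  · rw [hMplus]
    refine posSemidef_sum _ fun i _ => PosSemidef.smul ?_ (le_max_right _ _)
    simpa using posSemidef_vecMulVec_self_star (u i)
  · have hdiff : Mplus - M = ∑ i, (max (lam i) 0 - lam i) • vecMulVec (u i) (u i) := by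
      simp only [hMplus, hM, sub_smul, Finset.sum_sub_distrib]
    rw [sub_sub_sub_cancel_right, hdiff, sum_mul_sum_smul_vecMulVec_self]
    refine Finset.sum_nonneg fun k _ => ?_
    have hSk : 0 ≤ u k ⬝ᵥ S *ᵥ u k := by simpa using hS.dotProduct_mulVec_nonneg (u k)
    rw [sub_mulVec, dotProduct_sub, hMplus, dotProduct_sum_smul_vecMulVec_mulVec _ u horth]
    rcases le_total (lam k) 0 with h | h
    · rw [max_eq_right h]
      exact mul_nonneg (by linarith) (by linarith)
    · simp [max_eq_left h]
end
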